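/- Let G be an infinite finitely generated group with decidable word problem, let H be a finitely generated nonabelian group, and let A ⊆ ℕ. Then A many-one reduces to WP(K(G,A,H)) (with respect to the distinguished generating set of K(G,A,H)). -/

import Mathlib

open Classical in
/-- Characteristic sequence of a set of naturals. -/
noncomputable def charSeq (A : Set ℕ) : ℕ → Bool := fun i => decide (i ∈ A)

/-- The length-`m` prefix of the characteristic sequence of `A`. -/
noncomputable def charPrefix (A : Set ℕ) (m : ℕ) : List Bool :=
  (List.range m).map (charSeq A)

/-- `A` is Σ⁰₁ (recursively enumerable). -/
def IsSigma01 (A : Set ℕ) : Prop :=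
  ∃ f : ℕ →. ℕ, Partrec f ∧ ∀ n, n ∈ A ↔ (f n).Dom

/-- `A` many-one reduces to `B`. -/
def ManyOneRed (A B : Set ℕ) : Prop :=
  ∃ f : ℕ → ℕ, Computable f ∧ ∀ n, n ∈ A ↔ f n ∈ B

/-- `A` is `φ`-impredictable with witness `ψ`. -/
def ImpredictableWith (φ : ℕ → ℕ) (A : Set ℕ) (ψ : ℕ → ℕ) : Prop :=
  ∀ χ : ℕ × List Bool →. ℕ, Partrec χ →
    ∀ N : ℕ, ∃ p : ℕ, N ≤ p ∧ (ψ p ∈ A ↔ (χ (p, charPrefix A (φ p))).Dom)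

/-- `A` is `φ`-impredictable. -/
def Impredictable (φ : ℕ → ℕ) (A : Set ℕ) : Prop :=
  ∃ ψ : ℕ → ℕ, Computable ψ ∧ ImpredictableWith φ A ψ

/-- Bitwise comparison of binary strings of equal length. -/
def bitLE (u v : List Bool) : Prop := List.Forall₂ (· ≤ ·) u v

/-- `B` wtt-reduces to `A` with rate `β`. -/
def WttRedRate (B A : Set ℕ) (β : ℕ → ℕ) : Prop :=
  Computable β ∧ Monotone β ∧ Filter.Tendsto β Filter.atTop Filter.atTop ∧
  ∃ g : List Bool →. List Bool, Partrec g ∧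
    ∀ m : ℕ, ∃ out : List Bool, out ∈ g (charPrefix A m) ∧
      out = charPrefix B out.length ∧ β m ≤ out.length

/-- `B` conjunctively reduces to `A` with rate `β`. -/
def ConjRedRate (B A : Set ℕ) (β : ℕ → ℕ) : Prop :=
  Computable β ∧ Monotone β ∧ Filter.Tendsto β Filter.atTop Filter.atTop ∧
  ∃ g : List Bool → List Bool, Computable g ∧
    (∀ w : List Bool, (g w).length = β w.length) ∧
    (∀ u v : List Bool, bitLE u v → bitLE (g u) (g v)) ∧
    (∀ m : ℕ, g (charPrefix A m) = charPrefix B (β m)) ∧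
    ∃ w : ℕ → ℕ → List Bool, Computable₂ w ∧ (∀ i m, (w i m).length = m) ∧
      ∀ (u v : List Bool) (i : ℕ), u.length = v.length →
        (bitLE (w i u.length) u ↔ bitLE (w i u.length) v) →
        (g u).getD i false = (g v).getD i false

/-- Evaluation of a word over the generators (`true` = generator, `false` = inverse). -/
def evalWord {K : Type*} [Group K] {m : ℕ} (gen : Fin m → K) (w : List (Fin m × Bool)) : K :=
  (w.map fun l => if l.2 then gen l.1 else (gen l.1)⁻¹).prod

/-- Index of a word in the length-then-lexicographic enumeration of all words
(bijective base-`2m` numeration). -/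
def wordCode {m : ℕ} (w : List (Fin m × Bool)) : ℕ :=
  w.foldl (fun acc l => acc * (2 * m) + (2 * l.1.val + (if l.2 then 1 else 0) + 1)) 0

/-- The word problem of a group with distinguished generators. -/
def WordProblem {K : Type*} [Group K] {m : ℕ} (gen : Fin m → K) : Set ℕ :=
  { n | ∃ w : List (Fin m × Bool), wordCode w = n ∧ evalWord gen w = 1 }

/-- Word norm with respect to the distinguished generators. -/
noncomputable def wordNorm {K : Type*} [Group K] {m : ℕ} (gen : Fin m → K) (g : K) : ℕ :=
  sInf { ℓ | ∃ w : List (Fin m × Bool), w.length = ℓ ∧ evalWord gen w = g }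

/-- The torsion function of a group with distinguished generators. -/
noncomputable def torsionFn {K : Type*} [Group K] {m : ℕ} (gen : Fin m → K) (n : ℕ) : ℕ :=
  sSup { k | ∃ g : K, wordNorm gen g ≤ n ∧ orderOf g = k }

/-- Word metric on a group with distinguished generators. -/
noncomputable def wordDist {G : Type*} [Group G] {m : ℕ} (gen : Fin m → G) (a b : G) : ℕ :=
  wordNorm gen (a⁻¹ * b)

/-- The subshift `X_A`: configurations with at most two `1`s, whose distance is not in `A`. -/
def XA {G : Type*} [Group G] {m : ℕ} (gen : Fin m → G) (A : Set ℕ) : Set (G → Bool) :=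
  { x | (∀ a b c : G, x a = true → x b = true → x c = true → a = b ∨ a = c ∨ b = c) ∧
        (∀ a b : G, x a = true → x b = true → a ≠ b → wordDist gen a b ∉ A) }

/-- Shift action on configurations. -/
def shiftC {G : Type*} [Group G] {α : Type*} (g : G) (x : G → α) : G → α :=
  fun k => x (g⁻¹ * k)

theorem shiftC_mem_XA {G : Type*} [Group G] {m : ℕ} (gen : Fin m → G) (A : Set ℕ)
    (g : G) {x : G → Bool} (hx : x ∈ XA gen A) : shiftC g x ∈ XA gen A := by
  obtain ⟨h1, h2⟩ := hx
  constructor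
  · intro a b c ha hb hc
    rcases h1 _ _ _ ha hb hc with h | h | h
    · exact Or.inl (mul_left_cancel h)
    · exact Or.inr (Or.inl (mul_left_cancel h))
    · exact Or.inr (Or.inr (mul_left_cancel h))
  · intro a b ha hb hab
    have hab' : g⁻¹ * a ≠ g⁻¹ * b := fun h => hab (mul_left_cancel h)
    have hd := h2 _ _ ha hb hab'
    have he : wordDist gen (g⁻¹ * a) (g⁻¹ * b) = wordDist gen a b := by
      unfold wordDist
      congr 1
      group
    rwa [he] at hd

/-- The generator `ĝ` of `K(G,A,H)`: shift in the first component. -/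
def ghat {G : Type*} [Group G] {m : ℕ} (gen : Fin m → G) (A : Set ℕ)
    (H : Type*) (g : G) : Equiv.Perm (↥(XA gen A) × H) where
  toFun p := (⟨shiftC g p.1.1, shiftC_mem_XA gen A g p.1.2⟩, p.2)
  invFun p := (⟨shiftC g⁻¹ p.1.1, shiftC_mem_XA gen A g⁻¹ p.1.2⟩, p.2)
  left_inv := by
    rintro ⟨⟨x, hx⟩, h'⟩
    simp only [Prod.mk.injEq, Subtype.mk.injEq]
    refine ⟨?_, trivial⟩
    funext k
    show x (g⁻¹ * ((g⁻¹)⁻¹ * k)) = x k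
    congr 1
    group
  right_inv := by
    rintro ⟨⟨x, hx⟩, h'⟩
    simp only [Prod.mk.injEq, Subtype.mk.injEq]
    refine ⟨?_, trivial⟩
    funext k
    show x ((g⁻¹)⁻¹ * (g⁻¹ * k)) = x k
    congr 1
    group

/-- The generator `h_b` of `K(G,A,H)`: multiply the `H`-component by `h`
if the configuration reads `b` at the identity. -/
def hbGen {G : Type*} [Group G] {m : ℕ} (gen : Fin m → G) (A : Set ℕ)
    {H : Type*} [Group H] (h : H) (b : Bool) : Equiv.Perm (↥(XA gen A) × H) where
  toFun p := (p.1, if p.1.1 1 = b then h * p.2 else p.2)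
  invFun p := (p.1, if p.1.1 1 = b then h⁻¹ * p.2 else p.2)
  left_inv := by
    rintro ⟨x, h'⟩
    by_cases hc : x.1 1 = b <;> simp [hc]
  right_inv := by
    rintro ⟨x, h'⟩
    by_cases hc : x.1 1 = b <;> simp [hc]

/-- The group `K(G,A,H)` as a subgroup of the permutations of `X_A × H`. -/
def Ksub {G : Type*} [Group G] {m : ℕ} (gen : Fin m → G) (A : Set ℕ)
    (H : Type*) [Group H] : Subgroup (Equiv.Perm (↥(XA gen A) × H)) :=
  Subgroup.closure
    ((Set.range fun g : G => ghat gen A H g) ∪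
     (Set.range fun p : H × Bool => hbGen gen A p.1 p.2))

theorem ghat_mem {G : Type*} [Group G] {m : ℕ} (gen : Fin m → G) (A : Set ℕ)
    (H : Type*) [Group H] (g : G) : ghat gen A H g ∈ Ksub gen A H :=
  Subgroup.subset_closure (Or.inl ⟨g, rfl⟩)

theorem hb_mem {G : Type*} [Group G] {m : ℕ} (gen : Fin m → G) (A : Set ℕ)
    {H : Type*} [Group H] (h : H) (b : Bool) : hbGen gen A h b ∈ Ksub gen A H :=
  Subgroup.subset_closure (Or.inr ⟨(h, b), rfl⟩)

/-- The distinguished generating set of `K(G,A,H)`: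
the `ĝ` for `g` among the generators of `G`, and the `h_b` for `h` among
the generators of `H` and `b ∈ {0,1}`. -/
def genKGen {G H : Type*} [Group G] [Group H] {mG nH : ℕ}
    (genG : Fin mG → G) (genH : Fin nH → H) (A : Set ℕ) :
    Fin (mG + 2 * nH) → ↥(Ksub genG A H) := fun i =>
  if h : (i : ℕ) < mG then ⟨ghat genG A H (genG ⟨i, h⟩), ghat_mem genG A H _⟩
  else
    ⟨hbGen genG A (genH ⟨((i : ℕ) - mG) / 2, by have := i.isLt; omega⟩)
        (decide (((i : ℕ) - mG) % 2 = 1)),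
      hb_mem genG A _ _⟩

/-! ### Words -/

section Words

variable {K : Type*} [Group K] {m : ℕ}

theorem evalWord_append (gen : Fin m → K) (u v : List (Fin m × Bool)) :
    evalWord gen (u ++ v) = evalWord gen u * evalWord gen v := by
  simp [evalWord]

/-- The formal inverse of a word. -/
def invWord (w : List (Fin m × Bool)) : List (Fin m × Bool) :=
  (w.map fun l => (l.1, !l.2)).reverse

theorem invWord_length (w : List (Fin m × Bool)) : (invWord w).length = w.length := by
  simp [invWord]

theorem evalWord_inv (gen : Fin m → K) (w : List (Fin m × Bool)) :
    evalWord gen (invWord w) = (evalWord gen w)⁻¹ := by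
  induction w with
  | nil => simp [invWord, evalWord]
  | cons l w ih =>
    have h1 : invWord (l :: w) = invWord w ++ [(l.1, !l.2)] := by simp [invWord]
    have h2 : l :: w = [l] ++ w := rfl
    rw [h1, evalWord_append, ih, h2, evalWord_append, mul_inv_rev]
    congr 1
    rcases l with ⟨i, b⟩
    cases b <;> simp [evalWord]

theorem evalWord_hom {L : Type*} [Group L] (φ : K →* L) (gen : Fin m → K)
    (w : List (Fin m × Bool)) :
    evalWord (fun i => φ (gen i)) w = φ (evalWord gen w) := by
  induction w with
  | nil => simp [evalWord]
  | cons l w ih =>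
    have h2 : l :: w = [l] ++ w := rfl
    rw [h2, evalWord_append, evalWord_append, ih, map_mul]
    congr 1
    rcases l with ⟨i, b⟩
    cases b <;> simp [evalWord]

/-- Renaming of generators. -/
def mapWord {k : ℕ} (σ : Fin k → Fin m) (w : List (Fin k × Bool)) : List (Fin m × Bool) :=
  w.map fun l => (σ l.1, l.2)

theorem evalWord_mapWord {k : ℕ} (gen : Fin m → K) (σ : Fin k → Fin m)
    (w : List (Fin k × Bool)) :
    evalWord gen (mapWord σ w) = evalWord (fun i => gen (σ i)) w := by
  simp [evalWord, mapWord, Function.comp_def]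

theorem exists_word (gen : Fin m → K) (h : Subgroup.closure (Set.range gen) = ⊤) (g : K) :
    ∃ w, evalWord gen w = g := by
  have hg : g ∈ Subgroup.closure (Set.range gen) := by rw [h]; trivial
  induction hg using Subgroup.closure_induction with
  | mem x hx =>
    obtain ⟨i, rfl⟩ := hx
    exact ⟨[(i, true)], by simp [evalWord]⟩
  | one => exact ⟨[], by simp [evalWord]⟩
  | mul x y _ _ hx hy =>
    obtain ⟨u, hu⟩ := hx
    obtain ⟨v, hv⟩ := hy
    exact ⟨u ++ v, by rw [evalWord_append, hu, hv]⟩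
  | inv x _ hx =>
    obtain ⟨u, hu⟩ := hx
    exact ⟨invWord u, by rw [evalWord_inv, hu]⟩

theorem wordCode_snoc (w : List (Fin m × Bool)) (l : Fin m × Bool) :
    wordCode (w ++ [l]) =
      wordCode w * (2 * m) + (2 * l.1.val + (if l.2 then 1 else 0) + 1) := by
  simp [wordCode]

theorem wordCode_inj (w w' : List (Fin m × Bool)) (h : wordCode w = wordCode w') : w = w' := by
  induction w using List.reverseRecOn generalizing w' with
  | nil =>
    rcases List.eq_nil_or_concat w' with rfl | ⟨v, l, rfl⟩
    · rfl
    · rw [List.concat_eq_append, wordCode_snoc] at h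
      simp [wordCode] at h
  | append_singleton u l ih =>
    rcases List.eq_nil_or_concat w' with rfl | ⟨v, l', rfl⟩
    · rw [wordCode_snoc] at h
      simp [wordCode] at h
    · rw [List.concat_eq_append] at h ⊢
      rw [wordCode_snoc, wordCode_snoc] at h
      obtain ⟨⟨i, hi⟩, b⟩ := l
      obtain ⟨⟨j, hj⟩, c⟩ := l'
      have key : ∀ (x y d e : ℕ), d < 2 * m → e < 2 * m →
          x * (2 * m) + (d + 1) = y * (2 * m) + (e + 1) → x = y ∧ d = e := by
        intro x y d e hd he hxy
        have hxy' : d + (2 * m) * x = e + (2 * m) * y := by nlinarith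
        have hm : 0 < 2 * m := by omega
        have h1 := congrArg (· / (2 * m)) hxy'
        have h2 := congrArg (· % (2 * m)) hxy'
        simp only [Nat.add_mul_div_left _ _ hm, Nat.add_mul_mod_self_left,
          Nat.div_eq_of_lt hd, Nat.div_eq_of_lt he, Nat.mod_eq_of_lt hd,
          Nat.mod_eq_of_lt he] at h1 h2
        exact ⟨by omega, h2⟩
      have hd : 2 * i + (if b then 1 else 0) < 2 * m := by cases b <;> simp <;> omega
      have he : 2 * j + (if c then 1 else 0) < 2 * m := by cases c <;> simp <;> omega
      obtain ⟨h1, h2⟩ := key _ _ _ _ hd he h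
      rw [ih v h1]
      cases b <;> cases c <;> simp at h2 <;> first | omega | (subst h2; rfl)

theorem mem_WordProblem (gen : Fin m → K) (w : List (Fin m × Bool)) :
    wordCode w ∈ WordProblem gen ↔ evalWord gen w = 1 := by
  constructor
  · rintro ⟨v, hv, h⟩
    rwa [← wordCode_inj _ _ hv]
  · intro h
    exact ⟨w, rfl, h⟩

/-- Geodesic word, in a form convenient for computation. -/
def IsGeo (gen : Fin m → K) (w : List (Fin m × Bool)) : Prop :=
  ∀ v : List (Fin m × Bool), v.length < w.length → evalWord gen (w ++ v) ≠ 1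

theorem IsGeo.le {gen : Fin m → K} {w v : List (Fin m × Bool)} (hw : IsGeo gen w)
    (h : evalWord gen v = evalWord gen w) : w.length ≤ v.length := by
  by_contra hlt
  refine hw (invWord v) (by rw [invWord_length]; omega) ?_
  rw [evalWord_append, evalWord_inv, h, mul_inv_cancel]

theorem IsGeo.norm {gen : Fin m → K} {w : List (Fin m × Bool)} (hw : IsGeo gen w) :
    wordNorm gen (evalWord gen w) = w.length := by
  apply le_antisymm
  · exact Nat.sInf_le ⟨w, rfl, rfl⟩
  · refine le_csInf ⟨_, w, rfl, rfl⟩ ?_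
    rintro l ⟨v, rfl, h⟩
    exact hw.le h

theorem IsGeo.norm_inv {gen : Fin m → K} {w : List (Fin m × Bool)} (hw : IsGeo gen w) :
    wordNorm gen (evalWord gen w)⁻¹ = w.length := by
  apply le_antisymm
  · exact Nat.sInf_le ⟨invWord w, invWord_length w, evalWord_inv gen w⟩
  · refine le_csInf ⟨_, invWord w, rfl, evalWord_inv gen w⟩ ?_
    rintro l ⟨v, rfl, h⟩
    rw [← invWord_length v]
    refine hw.le ?_
    rw [evalWord_inv, h, inv_inv]

theorem exists_geo (gen : Fin m → K) (hgen : Subgroup.closure (Set.range gen) = ⊤)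
    [Infinite K] (n : ℕ) : ∃ w, w.length = n ∧ IsGeo gen w := by
  have hfin : (evalWord gen '' {w : List (Fin m × Bool) | w.length < n}).Finite :=
    (List.finite_length_lt _ n).image _
  obtain ⟨g, hg⟩ := hfin.exists_notMem
  obtain ⟨w0, hw0⟩ := exists_word gen hgen g
  have hex : ∃ l, ∃ w, w.length = l ∧ evalWord gen w = g := ⟨_, w0, rfl, hw0⟩
  classical
  obtain ⟨w, hwl, hwg⟩ := Nat.find_spec hex
  have hmin : ∀ v, evalWord gen v = g → w.length ≤ v.length := by
    intro v hv
    rw [hwl]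
    exact Nat.find_min' hex ⟨v, rfl, hv⟩
  have hn : n ≤ w.length := by
    by_contra hlt
    exact hg ⟨w, by simpa using hlt, hwg⟩
  refine ⟨w.take n, by simp [hn], ?_⟩
  intro v hv h
  rw [evalWord_append] at h
  have h1 : evalWord gen (invWord v ++ w.drop n) = g := by
    rw [evalWord_append, evalWord_inv, ← eq_inv_of_mul_eq_one_left h, ← evalWord_append,
      List.take_append_drop, hwg]
  have h2 := hmin _ h1
  simp [invWord_length] at h2 hv
  omega

end Words

/-! ### Computability -/

section Comp

theorem primrec_wordCode (m : ℕ) : Primrec (wordCode (m := m)) := by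
  unfold wordCode
  refine Primrec.list_foldl (h := fun _ (p : ℕ × (Fin m × Bool)) => p.1 * (2 * m) +
    (2 * p.2.1.val + (if p.2.2 then 1 else 0) + 1)) Primrec.id (Primrec.const 0) ?_
  have h1 : Primrec fun l : Fin m × Bool => 2 * l.1.val + (if l.2 then 1 else 0) + 1 :=
    Primrec.dom_finite _
  exact Primrec.nat_add.comp
    (Primrec.nat_mul.comp (Primrec.fst.comp Primrec.snd) (Primrec.const _))
    (h1.comp (Primrec.snd.comp Primrec.snd))

theorem primrec_invWord (m : ℕ) : Primrec (invWord (m := m)) := by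
  unfold invWord
  refine Primrec.list_reverse.comp (Primrec.list_map Primrec.id ?_)
  exact (Primrec.dom_finite (fun l : Fin m × Bool => (l.1, !l.2))).comp Primrec.snd

theorem primrec_mapWord {k m : ℕ} (σ : Fin k → Fin m) : Primrec (mapWord σ) := by
  unfold mapWord
  refine Primrec.list_map Primrec.id ?_
  exact (Primrec.dom_finite (fun l : Fin k × Bool => (σ l.1, l.2))).comp Primrec.snd

/-- All words of length less than `n`. -/
noncomputable def ballWords (m : ℕ) (n : ℕ) : List (List (Fin m × Bool)) :=
  Nat.rec [] (fun _ L => [] :: L.flatMap fun w =>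
    (Finset.univ : Finset (Fin m × Bool)).toList.map fun l => l :: w) n

theorem mem_ballWords (m n : ℕ) (w : List (Fin m × Bool)) :
    w ∈ ballWords m n ↔ w.length < n := by
  induction n generalizing w with
  | zero => simp [ballWords]
  | succ n ih =>
    have h : ballWords m (n + 1) = [] :: (ballWords m n).flatMap fun w =>
      (Finset.univ : Finset (Fin m × Bool)).toList.map fun l => l :: w := rfl
    rw [h]
    cases w with
    | nil => simp
    | cons l w => simp [← ih]

theorem primrec_ballWords (m : ℕ) : Primrec (ballWords m) := by
  unfold ballWords
  refine Primrec.nat_rec₁ _ ?_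
  refine Primrec.list_cons.comp (Primrec.const _) ?_
  refine Primrec.list_flatMap Primrec.snd ?_
  refine Primrec.list_map (Primrec.const _) ?_
  exact Primrec.list_cons.comp Primrec.snd (Primrec.snd.comp Primrec.fst)

/-- Checks that the computable predicate fails on the whole list. -/
def noneHold (c : ℕ → Bool) (L : List ℕ) : Bool :=
  Nat.rec (motive := fun _ => Bool) true
    (fun i b => b && !(((L[i]?).map c).getD false)) L.length

theorem noneHold_iff (c : ℕ → Bool) (L : List ℕ) :
    noneHold c L = true ↔ ∀ v ∈ L, c v = false := by
  have key : ∀ k, Nat.rec (motive := fun _ => Bool) true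
    (fun i b => b && !(((L[i]?).map c).getD false)) k = true ↔
      ∀ i < k, ∀ v, L[i]? = some v → c v = false := by
    intro k
    induction k with
    | zero => simp
    | succ k ih =>
      simp only [Bool.and_eq_true, ih]
      constructor
      · rintro ⟨h1, h2⟩ i hi v hv
        rcases Nat.lt_succ_iff_lt_or_eq.1 hi with h | rfl
        · exact h1 i h v hv
        · simpa [hv] using h2
      · intro h
        refine ⟨fun i hi => h i (by omega), ?_⟩
        cases hv : L[k]? with
        | none => simp
        | some v => simpa using h k (by omega) v hv
  unfold noneHold
  rw [key]
  constructor
  · intro h v hv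
    obtain ⟨i, hi, rfl⟩ := List.getElem_of_mem hv
    exact h i hi _ (by simp [hi])
  · intro h i hi v hv
    exact h v (List.mem_of_getElem? hv)

theorem computable_noneHold {c : ℕ → Bool} (hc : Computable c) : Computable (noneHold c) := by
  unfold noneHold
  refine Computable.nat_rec (h := fun (L : List ℕ) p => p.2 && !(((L[p.1]?).map c).getD false))
    Computable.list_length (Computable.const true) ?_
  refine Primrec.and.to_comp.comp (Computable.snd.comp Computable.snd) ?_
  refine Primrec.not.to_comp.comp ?_
  refine Computable.option_getD ?_ (Computable.const false)
  refine Computable.option_map ?_ ?_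
  · exact Computable.list_getElem?.comp Computable.fst (Computable.fst.comp Computable.snd)
  · exact hc.comp Computable.snd

/-- Computable test whether the word is geodesic. -/
noncomputable def geoTest (m : ℕ) (c : ℕ → Bool) (w : List (Fin m × Bool)) : Bool :=
  noneHold c ((ballWords m w.length).map fun v => wordCode (w ++ v))

theorem computable_geoTest (m : ℕ) {c : ℕ → Bool} (hc : Computable c) :
    Computable (geoTest m c) := by
  refine (computable_noneHold hc).comp (Primrec.to_comp ?_)
  refine Primrec.list_map ((primrec_ballWords m).comp Primrec.list_length) ?_
  exact (primrec_wordCode m).comp (Primrec.list_append.comp Primrec.fst Primrec.snd)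

theorem geoTest_iff {K : Type*} [Group K] {m : ℕ} (gen : Fin m → K) (c : ℕ → Bool)
    (hc : ∀ n, n ∈ WordProblem gen ↔ c n = true) (w : List (Fin m × Bool)) :
    geoTest m c w = true ↔ IsGeo gen w := by
  unfold geoTest IsGeo
  rw [noneHold_iff]
  simp only [List.mem_map, mem_ballWords, forall_exists_index, and_imp,
    forall_apply_eq_imp_iff₂, ne_eq, ← mem_WordProblem, hc, Bool.not_eq_true]

theorem exists_computable_geo {K : Type*} [Group K] {m : ℕ} (gen : Fin m → K)
    (hgen : Subgroup.closure (Set.range gen) = ⊤) [Infinite K]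
    (hdec : ComputablePred (· ∈ WordProblem gen)) :
    ∃ u : ℕ → List (Fin m × Bool), Computable u ∧ ∀ n, (u n).length = n ∧ IsGeo gen (u n) := by
  obtain ⟨c, hc, hceq⟩ := ComputablePred.computable_iff.1 hdec
  have hc' : ∀ n, n ∈ WordProblem gen ↔ c n = true := fun n => by
    have := congrFun hceq n
    simpa using this
  let f : ℕ → ℕ → Option (List (Fin m × Bool)) := fun n k =>
    (Encodable.decode (α := List (Fin m × Bool)) k).bind fun w =>
      cond (decide (w.length = n) && geoTest m c w) (some w) none
  have hf : Computable₂ f := by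
    refine Computable.option_bind (Computable.decode.comp Computable.snd) ?_
    refine Computable.cond ?_ (Computable.option_some.comp Computable.snd) (Computable.const _)
    refine Primrec.and.to_comp.comp ?_ ((computable_geoTest m hc).comp Computable.snd)
    have : Primrec fun p : (ℕ × ℕ) × List (Fin m × Bool) => decide (p.2.length = p.1.1) :=
      (Primrec.eq.comp (Primrec.list_length.comp Primrec.snd)
        (Primrec.fst.comp Primrec.fst)).decide
    exact this.to_comp
  have hspec : ∀ n k w, w ∈ f n k → w.length = n ∧ IsGeo gen w := by
    intro n k w h
    simp only [f, Option.mem_def, Option.bind_eq_some_iff] at h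
    obtain ⟨v, -, hv⟩ := h
    cases hb : (decide (v.length = n) && geoTest m c v) with
    | false => simp [hb] at hv
    | true =>
      simp only [hb, cond_true, Option.some.injEq] at hv
      subst hv
      simp only [Bool.and_eq_true, decide_eq_true_eq] at hb
      exact ⟨hb.1, (geoTest_iff gen c hc' _).1 hb.2⟩
  have hdom : ∀ n, (Nat.rfindOpt (f n)).Dom := by
    intro n
    rw [Nat.rfindOpt_dom]
    obtain ⟨w, hw, hgeo⟩ := exists_geo gen hgen n
    refine ⟨Encodable.encode w, w, ?_⟩
    simp [f, hw, (geoTest_iff gen c hc' _).2 hgeo]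
  refine ⟨fun n => (Nat.rfindOpt (f n)).get (hdom n), ?_, ?_⟩
  · exact (Partrec.rfindOpt hf).of_eq_tot fun n => Part.get_mem _
  · intro n
    obtain ⟨k, hk⟩ := Nat.rfindOpt_spec (Part.get_mem (hdom n))
    exact hspec n k _ hk

end Comp

/-! ### The group `K(G,A,H)` -/

section KGroup

variable {G H : Type*} [Group G] [Group H] {mG nH : ℕ}

/-- `ghat` as a homomorphism. -/
def ghatHom (genG : Fin mG → G) (A : Set ℕ) (H : Type*) :
    G →* Equiv.Perm (↥(XA genG A) × H) where
  toFun g := ghat genG A H g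
  map_one' := by
    ext1 ⟨⟨x, hx⟩, h⟩
    simp [ghat]
    funext k
    simp [shiftC]
  map_mul' g g' := by
    ext1 ⟨⟨x, hx⟩, h⟩
    simp [ghat]
    funext k
    simp [shiftC, mul_assoc]

/-- `h ↦ h_1` as a homomorphism. -/
def hbHom (genG : Fin mG → G) (A : Set ℕ) (H : Type*) [Group H] :
    H →* Equiv.Perm (↥(XA genG A) × H) where
  toFun h := hbGen genG A h true
  map_one' := by
    ext1 ⟨⟨x, hx⟩, h⟩
    simp [hbGen]
  map_mul' g g' := by
    ext1 ⟨⟨x, hx⟩, h⟩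
    by_cases hx1 : x 1 = true <;> simp [hbGen, hx1, mul_assoc]

/-- Index of the generator of `G`. -/
def idxG (mG nH : ℕ) (i : Fin mG) : Fin (mG + 2 * nH) := ⟨i, by omega⟩

/-- Index of the generator `h_1`. -/
def idxH (mG nH : ℕ) (i : Fin nH) : Fin (mG + 2 * nH) := ⟨mG + 2 * i + 1, by omega⟩

theorem genK_idxG (genG : Fin mG → G) (genH : Fin nH → H) (A : Set ℕ) (i : Fin mG) :
    (genKGen genG genH A (idxG mG nH i) : Equiv.Perm (↥(XA genG A) × H)) =
      ghatHom genG A H (genG i) := by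
  simp [genKGen, idxG, ghatHom]

theorem genK_idxH (genG : Fin mG → G) (genH : Fin nH → H) (A : Set ℕ) (i : Fin nH) :
    (genKGen genG genH A (idxH mG nH i) : Equiv.Perm (↥(XA genG A) × H)) =
      hbHom genG A H (genH i) := by
  have h0 : ¬ (mG + 2 * (i : ℕ) + 1 < mG) := by omega
  have h1 : (mG + 2 * (i : ℕ) + 1 - mG) / 2 = i := by omega
  have h2 : (mG + 2 * (i : ℕ) + 1 - mG) % 2 = 1 := by omega
  simp [genKGen, idxH, hbHom, h0, h1, h2]

theorem eval_G (genG : Fin mG → G) (genH : Fin nH → H) (A : Set ℕ)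
    (w : List (Fin mG × Bool)) :
    ((evalWord (genKGen genG genH A) (mapWord (idxG mG nH) w) : ↥(Ksub genG A H)) :
      Equiv.Perm (↥(XA genG A) × H)) = ghatHom genG A H (evalWord genG w) := by
  rw [← Subgroup.subtype_apply, ← evalWord_hom, evalWord_mapWord, ← evalWord_hom]
  congr 1
  funext i
  exact genK_idxG genG genH A i

theorem eval_H (genG : Fin mG → G) (genH : Fin nH → H) (A : Set ℕ)
    (w : List (Fin nH × Bool)) :
    ((evalWord (genKGen genG genH A) (mapWord (idxH mG nH) w) : ↥(Ksub genG A H)) :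
      Equiv.Perm (↥(XA genG A) × H)) = hbHom genG A H (evalWord genH w) := by
  rw [← Subgroup.subtype_apply, ← evalWord_hom, evalWord_mapWord, ← evalWord_hom]
  congr 1
  funext i
  exact genK_idxH genG genH A i

theorem conj_apply (genG : Fin mG → G) (A : Set ℕ) (g : G) (b : H)
    (x : ↥(XA genG A)) (h : H) :
    (ghatHom genG A H g * hbHom genG A H b * (ghatHom genG A H g)⁻¹) (x, h) =
      (x, if x.1 g = true then b * h else h) := by
  rw [← map_inv]
  obtain ⟨x, hx⟩ := x
  have hx' : shiftC g (shiftC g⁻¹ x) = x := by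
    funext k
    simp [shiftC]
  simp [ghatHom, hbHom, ghat, hbGen, hx']
  simp [shiftC]

/-- The commutator of `a_1` with a conjugate of `b_1`. -/
theorem comm_eq_one_iff (genG : Fin mG → G) (A : Set ℕ) (g : G) (a b : H)
    (hab : a * b ≠ b * a) :
    hbHom genG A H a * (ghatHom genG A H g * hbHom genG A H b * (ghatHom genG A H g)⁻¹) *
      (hbHom genG A H a)⁻¹ *
      (ghatHom genG A H g * hbHom genG A H b * (ghatHom genG A H g)⁻¹)⁻¹ = 1 ↔
    ∀ x ∈ XA genG A, ¬ (x 1 = true ∧ x g = true) := by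
  rw [mul_inv_eq_one, mul_inv_eq_iff_eq_mul]
  have ha : ∀ (x : ↥(XA genG A)) (h : H), hbHom genG A H a (x, h) =
      (x, if x.1 1 = true then a * h else h) := fun x h => rfl
  constructor
  · rintro h x hx ⟨h1, hg⟩
    have := Equiv.congr_fun h (⟨x, hx⟩, 1)
    rw [Equiv.Perm.mul_apply, Equiv.Perm.mul_apply (_ * _ * _), conj_apply, ha, ha,
      conj_apply] at this
    simp [h1, hg] at this
    exact hab this
  · intro h
    ext1 ⟨x, k⟩
    rw [Equiv.Perm.mul_apply, Equiv.Perm.mul_apply (_ * _ * _), conj_apply, ha, ha,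
      conj_apply]
    have := h x.1 x.2
    by_cases h1 : x.1 1 = true <;> by_cases hg : x.1 g = true <;> simp_all

/-- The word witnessing the reduction. -/
def redWord (mG nH : ℕ) (wa wb : List (Fin nH × Bool)) (u : List (Fin mG × Bool)) :
    List (Fin (mG + 2 * nH) × Bool) :=
  let c := mapWord (idxG mG nH) u ++ mapWord (idxH mG nH) wb ++
    invWord (mapWord (idxG mG nH) u)
  mapWord (idxH mG nH) wa ++ c ++ invWord (mapWord (idxH mG nH) wa) ++ invWord c

theorem primrec_redWord (mG nH : ℕ) (wa wb : List (Fin nH × Bool)) :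
    Primrec (redWord mG nH wa wb) := by
  have hu : Primrec (mapWord (idxG mG nH)) := primrec_mapWord _
  have hc : Primrec fun u : List (Fin mG × Bool) =>
      mapWord (idxG mG nH) u ++ mapWord (idxH mG nH) wb ++
        invWord (mapWord (idxG mG nH) u) :=
    Primrec.list_append.comp (Primrec.list_append.comp hu (Primrec.const _))
      ((primrec_invWord _).comp hu)
  exact Primrec.list_append.comp (Primrec.list_append.comp
    (Primrec.list_append.comp (Primrec.const _) hc) (Primrec.const _))
    ((primrec_invWord _).comp hc)

theorem eval_redWord (genG : Fin mG → G) (genH : Fin nH → H) (A : Set ℕ)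
    (wa wb : List (Fin nH × Bool)) (u : List (Fin mG × Bool))
    (hab : evalWord genH wa * evalWord genH wb ≠ evalWord genH wb * evalWord genH wa) :
    evalWord (genKGen genG genH A) (redWord mG nH wa wb u) = 1 ↔
      ∀ x ∈ XA genG A, ¬ (x 1 = true ∧ x (evalWord genG u) = true) := by
  rw [← comm_eq_one_iff genG A (evalWord genG u) _ _ hab, ← Subtype.coe_inj]
  simp only [redWord, evalWord_append, evalWord_inv, Subgroup.coe_mul, Subgroup.coe_inv,
    eval_G, eval_H, Subgroup.coe_one]

theorem indicator_mem (genG : Fin mG → G) (A : Set ℕ) (g : G)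
    (h1 : g = 1 ∨ (wordNorm genG g ∉ A ∧ wordNorm genG g⁻¹ ∉ A)) :
    ∃ x ∈ XA genG A, x 1 = true ∧ x g = true := by
  classical
  refine ⟨fun k => decide (k = 1 ∨ k = g), ⟨?_, ?_⟩, by simp, by simp⟩
  · intro a b c ha hb hc
    simp only [decide_eq_true_eq] at ha hb hc
    rcases ha with rfl | rfl <;> rcases hb with rfl | rfl <;> rcases hc with rfl | rfl <;> simp
  · intro a b ha hb hne
    simp only [decide_eq_true_eq] at ha hb
    rcases ha with rfl | rfl <;> rcases hb with rfl | rfl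
    · exact absurd rfl hne
    · rcases h1 with h | h
      · exact absurd h.symm hne
      · simpa [wordDist] using h.1
    · rcases h1 with h | h
      · exact absurd h hne
      · simpa [wordDist] using h.2
    · exact absurd rfl hne

end KGroup

/-- If `G` is infinite with decidable word problem and `H` is
nonabelian, then `A` many-one reduces to the word problem of `K(G,A,H)`. -/
theorem manyOne_to_Ksub {G H : Type*} [Group G] [Group H] {mG nH : ℕ}
    (genG : Fin mG → G) (genH : Fin nH → H)
    (hG : Subgroup.closure (Set.range genG) = ⊤)
    (hH : Subgroup.closure (Set.range genH) = ⊤)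
    (hInf : Infinite G)
    (hdecG : ComputablePred (· ∈ WordProblem genG))
    (hnab : ∃ a b : H, a * b ≠ b * a)
    (A : Set ℕ) :
    ManyOneRed A (WordProblem (genKGen genG genH A)) := by
  classical
  obtain ⟨u, hu, hgeo⟩ := exists_computable_geo genG hG hdecG
  obtain ⟨a, b, hab⟩ := hnab
  obtain ⟨wa, rfl⟩ := exists_word genH hH a
  obtain ⟨wb, rfl⟩ := exists_word genH hH b
  -- a trivial and a nontrivial word, for the value at `0`
  obtain ⟨w0, hw0⟩ : ∃ w0, 0 ∈ A ↔ evalWord (genKGen genG genH A) w0 = 1 := by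
    by_cases h0 : 0 ∈ A
    · exact ⟨[], by simp [h0, evalWord]⟩
    · refine ⟨redWord mG nH wa wb [], ?_⟩
      rw [eval_redWord genG genH A wa wb [] hab]
      simp only [h0, false_iff]
      intro h
      obtain ⟨x, hx, hx'⟩ := indicator_mem genG A (evalWord genG []) (Or.inl rfl)
      exact h x hx hx'
  refine ⟨fun n => if n = 0 then wordCode w0 else wordCode (redWord mG nH wa wb (u n)), ?_, ?_⟩
  · refine ComputablePred.ite (Computable.const _) ?_ ?_
    · exact ((primrec_wordCode _).comp (primrec_redWord mG nH wa wb)).to_comp.comp hu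
    · exact ⟨inferInstance,
        (Primrec.eq.comp Primrec.id (Primrec.const 0)).decide.to_comp⟩
  · intro n
    rcases Nat.eq_zero_or_pos n with rfl | hn
    · simp only [if_true]
      rw [mem_WordProblem, hw0]
    · simp only [hn.ne', if_false]
      rw [mem_WordProblem, eval_redWord genG genH A wa wb _ hab]
      obtain ⟨hlen, hg⟩ := hgeo n
      have hn1 := hg.norm
      have hn2 := hg.norm_inv
      rw [hlen] at hn1 hn2
      constructor
      · rintro hA x ⟨-, hx⟩ ⟨h1, h2⟩
        have hne : (1 : G) ≠ evalWord genG (u n) := by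
          intro h
          have := hg [] (by simp only [List.length_nil]; omega)
          rw [List.append_nil] at this
          exact this h.symm
        refine hx _ _ h1 h2 hne ?_
        simpa [wordDist, hn1] using hA
      · intro h
        by_contra hA
        obtain ⟨x, hx, hx'⟩ := indicator_mem genG A (evalWord genG (u n))
          (Or.inr (by rw [hn1, hn2]; exact ⟨hA, hA⟩))
        exact h x hx hx'
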